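/- arXiv:2602.16268 — 6 statements merged into one kernel-verified Lean document; each statement's English description precedes it below -/
import Mathlib

section
/- Let H be a finite-dimensional real inner product space, and let u, v, b ∈ H be unit vectors with ⟨b,u⟩ = 0 and ⟨b,v⟩ = 0. Define the linear operator A : H → H by A(x) = ⟨v−u, x⟩·b + ⟨b, x⟩·(v−u) + ⟨u, x⟩·u − ⟨v, x⟩·v. Then the operator norm of A satisfies ‖A‖ ≤ √2 · ‖v − u‖. -/
open scoped RealInnerProductSpace

/-- For orthogonal `d` and `w`, the symmetric operator `|w⟩⟨d| + |d⟩⟨w|` has norm at most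
`‖d‖ * ‖w‖`. -/
theorem norm_inner_smul_add_inner_smul_le {H : Type*} [NormedAddCommGroup H]
    [InnerProductSpace ℝ H] {d w : H} (hdw : ⟪d, w⟫ = 0) (x : H) :
    ‖⟪d, x⟫ • w + ⟪w, x⟫ • d‖ ≤ ‖d‖ * ‖w‖ * ‖x‖ := by
  have hwd : ⟪w, d⟫ = 0 := by rw [real_inner_comm, hdw]
  set p := ⟪d, x⟫ with hp
  set q := ⟪w, x⟫ with hq
  have hN : ‖p • w + q • d‖ ^ 2 = p ^ 2 * ‖w‖ ^ 2 + q ^ 2 * ‖d‖ ^ 2 := by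
    rw [norm_add_sq_real, norm_smul, norm_smul, real_inner_smul_left, real_inner_smul_right,
      hwd, mul_pow, mul_pow, Real.norm_eq_abs, Real.norm_eq_abs, sq_abs, sq_abs]
    ring
  set z := (p * ‖w‖ ^ 2) • d + (q * ‖d‖ ^ 2) • w with hz
  have hzx : ⟪z, x⟫ = ‖p • w + q • d‖ ^ 2 := by
    rw [hN, hz, inner_add_left, real_inner_smul_left, real_inner_smul_left, ← hp, ← hq]
    ring
  have hzz : ‖z‖ ^ 2 = (‖d‖ * ‖w‖) ^ 2 * ‖p • w + q • d‖ ^ 2 := by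
    rw [hN, hz, norm_add_sq_real, norm_smul, norm_smul, real_inner_smul_left,
      real_inner_smul_right, hdw, mul_pow, mul_pow, Real.norm_eq_abs, Real.norm_eq_abs,
      sq_abs, sq_abs]
    ring
  have hz_norm : ‖z‖ = ‖d‖ * ‖w‖ * ‖p • w + q • d‖ := by
    rw [← mul_pow] at hzz
    exact (pow_left_inj₀ (norm_nonneg _) (by positivity) two_ne_zero).1 hzz
  have hcs := real_inner_le_norm z x
  rw [hzx, hz_norm] at hcs
  rcases (norm_nonneg (p • w + q • d)).eq_or_lt with h | h
  · rw [← h]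
    positivity
  · exact le_of_mul_le_mul_right (by linarith) h

/-- In a finite-dimensional real inner product space, for unit vectors
`u, v, b` with `⟨b,u⟩ = 0` and `⟨b,v⟩ = 0`, the operator
`A = |b⟩⟨v−u| + |v−u⟩⟨b| + |u⟩⟨u| − |v⟩⟨v|` satisfies `‖A‖ ≤ √2 · ‖v − u‖`. -/
theorem stmt1 {H : Type*} [NormedAddCommGroup H] [InnerProductSpace ℝ H]
    [FiniteDimensional ℝ H]
    (u v b : H) (hu : ‖u‖ = 1) (hv : ‖v‖ = 1) (hb : ‖b‖ = 1)
    (hbu : ⟪b, u⟫ = 0) (hbv : ⟪b, v⟫ = 0)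
    (A : H →L[ℝ] H)
    (hA : ∀ x, A x = ⟪v - u, x⟫ • b + ⟪b, x⟫ • (v - u) + ⟪u, x⟫ • u - ⟪v, x⟫ • v) :
    ‖A‖ ≤ Real.sqrt 2 * ‖v - u‖ := by
  set w := b - (1 / 2 : ℝ) • (u + v) with hw
  have hdw : ⟪v - u, w⟫ = 0 := by
    rw [hw, inner_sub_right, real_inner_smul_right, inner_sub_left, real_inner_comm, hbv,
      real_inner_comm, hbu, inner_sub_left, inner_add_right, inner_add_right,
      real_inner_self_eq_norm_sq, real_inner_self_eq_norm_sq, hu, hv, real_inner_comm]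
    ring
  have hw_norm : ‖w‖ ≤ Real.sqrt 2 := by
    have huv : ‖u + v‖ ≤ 2 := (norm_add_le u v).trans (by rw [hu, hv]; norm_num)
    apply Real.le_sqrt_of_sq_le
    rw [hw, norm_sub_sq_real, real_inner_smul_right, inner_add_right, hbu, hbv, hb, norm_smul,
      Real.norm_eq_abs, abs_of_pos (by norm_num : (0 : ℝ) < 1 / 2)]
    nlinarith [norm_nonneg (u + v)]
  refine A.opNorm_le_bound (by positivity) fun x => ?_
  have hAx : A x = ⟪v - u, x⟫ • w + ⟪w, x⟫ • (v - u) := by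
    rw [hA, hw]
    simp only [inner_sub_left, inner_add_left, real_inner_smul_left]
    module
  calc ‖A x‖ ≤ ‖v - u‖ * ‖w‖ * ‖x‖ := hAx ▸ norm_inner_smul_add_inner_smul_le hdw x
    _ ≤ ‖v - u‖ * Real.sqrt 2 * ‖x‖ := by gcongr
    _ = Real.sqrt 2 * ‖v - u‖ * ‖x‖ := by ring
end

section
/- Let H be a finite-dimensional complex inner product space with an orthonormal basis (e_i)_{i ∈ I}, and let u, v ∈ H be unit vectors. Then ∑_{i ∈ I} | |⟨e_i, u⟩|² − |⟨e_i, v⟩|² | ≤ 2·‖u − v‖. -/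
open scoped BigOperators ComplexInnerProductSpace

theorem OrthonormalBasis.sum_norm_inner_mul_norm_inner_le {𝕜 E ι : Type*} [RCLike 𝕜]
    [NormedAddCommGroup E] [InnerProductSpace 𝕜 E] [Fintype ι] (b : OrthonormalBasis ι 𝕜 E)
    (x y : E) : ∑ i, ‖inner 𝕜 (b i) x‖ * ‖inner 𝕜 (b i) y‖ ≤ ‖x‖ * ‖y‖ := by
  simpa [b.sum_sq_norm_inner_right] using
    Real.sum_mul_le_sqrt_mul_sqrt Finset.univ (fun i ↦ ‖inner 𝕜 (b i) x‖)
      (fun i ↦ ‖inner 𝕜 (b i) y‖)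

theorem abs_norm_sq_sub_norm_sq_le {E : Type*} [SeminormedAddCommGroup E] (a b : E) :
    |‖a‖ ^ 2 - ‖b‖ ^ 2| ≤ ‖a - b‖ * ‖a‖ + ‖a - b‖ * ‖b‖ := by
  rw [sq_sub_sq, abs_mul, abs_of_nonneg (by positivity : 0 ≤ ‖a‖ + ‖b‖), ← mul_add, mul_comm]
  gcongr
  exact abs_norm_sub_norm_le a b

/-- For an orthonormal basis `(e_i)` of a finite-dimensional complex inner
product space and unit vectors `u, v`, the measurement outcome distributions satisfy
`∑ i, | |⟨e_i, u⟩|² − |⟨e_i, v⟩|² | ≤ 2·‖u − v‖`. -/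
theorem stmt6 {H : Type*} [NormedAddCommGroup H] [InnerProductSpace ℂ H]
    [FiniteDimensional ℂ H] {I : Type*} [Fintype I]
    (e : OrthonormalBasis I ℂ H)
    (u v : H) (hu : ‖u‖ = 1) (hv : ‖v‖ = 1) :
    ∑ i, |‖⟪e i, u⟫‖ ^ 2 - ‖⟪e i, v⟫‖ ^ 2| ≤ 2 * ‖u - v‖ := by
  calc ∑ i, |‖⟪e i, u⟫‖ ^ 2 - ‖⟪e i, v⟫‖ ^ 2|
      ≤ ∑ i, (‖⟪e i, u - v⟫‖ * ‖⟪e i, u⟫‖ + ‖⟪e i, u - v⟫‖ * ‖⟪e i, v⟫‖) := by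
        gcongr with i
        rw [inner_sub_right]
        exact abs_norm_sq_sub_norm_sq_le _ _
    _ ≤ ‖u - v‖ * ‖u‖ + ‖u - v‖ * ‖v‖ := by
        rw [Finset.sum_add_distrib]
        exact add_le_add (e.sum_norm_inner_mul_norm_inner_le _ _)
          (e.sum_norm_inner_mul_norm_inner_le _ _)
    _ = 2 * ‖u - v‖ := by rw [hu, hv]; ring
end

section
/- Fix n ∈ ℕ and a function f : (Fin n → Bool) → Bool. Let U_f be the linear isometry of EuclideanSpace ℂ ((Fin n → Bool) × Bool) that permutes the standard basis vectors by (x, y) ↦ (x, xor y (f x)). Let ξ be the vector whose coordinate at (x, y) is s(y)/√(2^{n+1}), where s(false) = 1 and s(true) = −1 (this is the state |+⟩^{⊗n} ⊗ |−⟩). Then ⟨ξ, U_f ξ⟩ = Z_f / 2^n, where Z_f := ∑_{x : Fin n → Bool} (−1)^{f x} (with (−1)^{false} = 1, (−1)^{true} = −1). In particular, the probability |⟨ξ, U_f ξ⟩|² that the Deutsch–Jozsa measurement returns the all-plus outcome equals (Z_f / 2^n)². -/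
open scoped BigOperators ComplexInnerProductSpace

/-- A linear isometry that permutes the standard basis by `(x, y) ↦ (x, y ⊕ f x)` acts on
coordinates by the same involution. -/
theorem oracle_apply {ι : Type*} [Fintype ι] [DecidableEq ι] (f : ι → Bool)
    (U : EuclideanSpace ℂ (ι × Bool) ≃ₗᵢ[ℂ] EuclideanSpace ℂ (ι × Bool))
    (hU : ∀ (x : ι) (y : Bool),
      U (EuclideanSpace.single (x, y) 1) = EuclideanSpace.single (x, xor y (f x)) 1)
    (v : EuclideanSpace ℂ (ι × Bool)) (x : ι) (y : Bool) :
    U v (x, y) = v (x, xor y (f x)) := by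
  have h := U.inner_map_map (EuclideanSpace.single (x, xor y (f x)) 1) v
  rw [hU] at h
  simpa [EuclideanSpace.inner_single_left] using h

/-- The Deutsch–Jozsa amplitude: for `f : (Fin n → Bool) → Bool` and the
oracle unitary `U_f : |x, y⟩ ↦ |x, y ⊕ f x⟩`, the state `ξ = |+⟩^{⊗n} ⊗ |−⟩` (coordinates
`s(y)/√(2^{n+1})` with `s(false)=1`, `s(true)=−1`) satisfies `⟨ξ, U_f ξ⟩ = Z_f / 2^n` where
`Z_f = ∑_x (−1)^{f x}`; in particular the all-plus outcome probability is `(Z_f / 2^n)²`. -/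
theorem stmt8 (n : ℕ) (f : (Fin n → Bool) → Bool)
    (Uf : EuclideanSpace ℂ ((Fin n → Bool) × Bool) ≃ₗᵢ[ℂ]
      EuclideanSpace ℂ ((Fin n → Bool) × Bool))
    (hUf : ∀ (x : Fin n → Bool) (y : Bool),
      Uf (EuclideanSpace.single (x, y) 1) = EuclideanSpace.single (x, xor y (f x)) 1)
    (ξ : EuclideanSpace ℂ ((Fin n → Bool) × Bool))
    (hξ : ∀ p : (Fin n → Bool) × Bool,
      ξ p = (((if p.2 then (-1 : ℝ) else 1) / Real.sqrt (2 ^ (n + 1)) : ℝ) : ℂ)) :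
    ⟪ξ, Uf ξ⟫ =
      (((∑ x : Fin n → Bool, if f x then (-1 : ℝ) else 1) / 2 ^ n : ℝ) : ℂ) ∧
    ‖⟪ξ, Uf ξ⟫‖ ^ 2 =
      ((∑ x : Fin n → Bool, if f x then (-1 : ℝ) else 1) / 2 ^ n) ^ 2 := by
  have key : ⟪ξ, Uf ξ⟫ =
      (((∑ x : Fin n → Bool, if f x then (-1 : ℝ) else 1) / 2 ^ n : ℝ) : ℂ) := by
    rw [PiLp.inner_apply, Fintype.sum_prod_type, Finset.sum_div, Complex.ofReal_sum]
    refine Finset.sum_congr rfl fun x _ => ?_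
    have hs : Real.sqrt (2 ^ (n + 1)) * Real.sqrt (2 ^ (n + 1)) = 2 ^ n * 2 := by
      rw [Real.mul_self_sqrt (by positivity), pow_succ]
    simp only [oracle_apply f Uf hUf, hξ, RCLike.inner_apply, Complex.conj_ofReal,
      Fintype.sum_bool, ← Complex.ofReal_mul, ← Complex.ofReal_add, div_mul_div_comm, hs]
    congr 1
    cases f x <;> simp <;> field_simp <;> norm_num
  refine ⟨key, ?_⟩
  rw [key, Complex.norm_real, Real.norm_eq_abs, sq_abs]
end

section
/- Fix p ∈ [0,1] and q ∈ (0,1) with p ≠ q. For each natural number N ≥ 1 set c_N := −N·(2q − 1), let μ_p and μ_q be the product Bernoulli measures on (Fin N → Bool) with parameter p respectively q (probability of false), and let Z_N(ω) := c_N + ∑_{i : Fin N} ε(ω(i)) with ε(false) = 1, ε(true) = −1. Then E_{μ_q}[Z_N²] = 4·N·q·(1 − q) > 0 and E_{μ_p}[Z_N²] = 4·N²·(p − q)² + 4·N·p·(1 − p), so that the ratio E_{μ_p}[Z_N²] / E_{μ_q}[Z_N²] = (N·(p − q)² + p·(1 − p)) / (q·(1 − q)), which tends to infinity as N → ∞.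 -/
open scoped BigOperators

/-- Splitting the first coordinate off a sum over Boolean vectors. -/
lemma sum_bool_vector_succ {M : Type*} [AddCommMonoid M] {n : ℕ} (f : (Fin (n + 1) → Bool) → M) :
    ∑ ω, f ω = ∑ ω : Fin n → Bool, (f (Fin.cons true ω) + f (Fin.cons false ω)) := by
  rw [← (Fin.consEquiv fun _ : Fin (n + 1) => Bool).sum_comp f, Fintype.sum_prod_type,
    Fintype.sum_bool, ← Finset.sum_add_distrib]
  rfl

/-- The second moment of a shifted sum of `n` independent signs, each equal to `1` with
weight `p` and to `-1` with weight `1 - p`. -/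
lemma sum_bernoulli_mul_sq_shifted_sign_sum (p c : ℝ) (n : ℕ) :
    ∑ ω : Fin n → Bool, (∏ i, (if ω i then 1 - p else p)) *
        (c + ∑ i, (if ω i then (-1 : ℝ) else 1)) ^ 2
      = (c + n * (2 * p - 1)) ^ 2 + 4 * n * p * (1 - p) := by
  induction n generalizing c with
  | zero => simp
  | succ n ih =>
    rw [sum_bool_vector_succ]
    simp only [Fin.prod_univ_succ, Fin.sum_univ_succ, Fin.cons_zero, Fin.cons_succ, if_true,
      Bool.false_eq_true, if_false, ← add_assoc, mul_assoc, Finset.sum_add_distrib,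
      ← Finset.mul_sum]
    rw [ih, ih]
    push_cast
    ring

/-- (Core computation of the counterexample to multiplicative quantum
oracle switching.) Fix `p ∈ [0,1]`, `q ∈ (0,1)` with `p ≠ q`. With `c_N = −N·(2q − 1)` and
`Z_N ω = c_N + ∑ i ε (ω i)` (`ε false = 1`, `ε true = −1`), under the product Bernoulli
weights with parameter `q` (probability of `false`) the second moment of `Z_N` equals
`4·N·q·(1 − q) > 0`, under parameter `p` it equals `4·N²·(p − q)² + 4·N·p·(1 − p)`, the
ratio equals `(N·(p − q)² + p·(1 − p)) / (q·(1 − q))`, and this ratio tends to infinity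
as `N → ∞`. -/
theorem stmt10 (p q : ℝ) (hp0 : 0 ≤ p) (hp1 : p ≤ 1) (hq0 : 0 < q) (hq1 : q < 1)
    (hpq : p ≠ q) :
    (∀ N : ℕ, 1 ≤ N →
      ∀ Z : (Fin N → Bool) → ℝ,
        (∀ ω, Z ω = -(N : ℝ) * (2 * q - 1) + ∑ i, (if ω i then (-1 : ℝ) else 1)) →
        ((∑ ω : Fin N → Bool, (∏ i, (if ω i then 1 - q else q)) * Z ω ^ 2)
            = 4 * N * q * (1 - q) ∧
          0 < 4 * (N : ℝ) * q * (1 - q) ∧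
          (∑ ω : Fin N → Bool, (∏ i, (if ω i then 1 - p else p)) * Z ω ^ 2)
            = 4 * (N : ℝ) ^ 2 * (p - q) ^ 2 + 4 * N * p * (1 - p) ∧
          (∑ ω : Fin N → Bool, (∏ i, (if ω i then 1 - p else p)) * Z ω ^ 2) /
              (∑ ω : Fin N → Bool, (∏ i, (if ω i then 1 - q else q)) * Z ω ^ 2)
            = ((N : ℝ) * (p - q) ^ 2 + p * (1 - p)) / (q * (1 - q)))) ∧
    Filter.Tendsto (fun N : ℕ => ((N : ℝ) * (p - q) ^ 2 + p * (1 - p)) / (q * (1 - q)))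
      Filter.atTop Filter.atTop := by
  have hqq : 0 < q * (1 - q) := mul_pos hq0 (sub_pos.2 hq1)
  have hd : 0 < (p - q) ^ 2 := sq_pos_of_ne_zero (sub_ne_zero.2 hpq)
  refine ⟨fun N hN Z hZ => ?_, ?_⟩
  · have hN0 : (0 : ℝ) < N := by exact_mod_cast hN
    have hmom (r : ℝ) : ∑ ω : Fin N → Bool, (∏ i, (if ω i then 1 - r else r)) * Z ω ^ 2
        = 4 * (N : ℝ) ^ 2 * (r - q) ^ 2 + 4 * N * r * (1 - r) := by
      simp only [hZ, sum_bernoulli_mul_sq_shifted_sign_sum]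
      ring
    have hmom_q : ∑ ω : Fin N → Bool, (∏ i, (if ω i then 1 - q else q)) * Z ω ^ 2
        = 4 * N * q * (1 - q) := by
      rw [hmom]
      ring
    have hpos : 0 < 4 * (N : ℝ) * q * (1 - q) := by
      have := sub_pos.2 hq1
      positivity
    refine ⟨hmom_q, hpos, hmom p, ?_⟩
    rw [hmom p, hmom_q, div_eq_div_iff hpos.ne' hqq.ne']
    ring
  · exact (Filter.tendsto_atTop_add_const_right _ _
      (tendsto_natCast_atTop_atTop.atTop_mul_const hd)).atTop_div_const hqq
end

section
/- Let Y be a finite nonempty type and P, Q : Y → ℝ probability mass functions with supp(P) ⊆ supp(Q), and let α ∈ ℝ with α > 1. For r ∈ ℕ let P^{⊗r} and Q^{⊗r} be the product distributions on (Fin r → Y) whose coordinates are i.i.d. according to P, respectively Q. Then for every subset E of (Fin r → Y): (P^{⊗r}(E))^{α/(α−1)} ≤ R_α(P‖Q)^r · Q^{⊗r}(E). -/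
open scoped BigOperators

/-- Probability preservation of the Rényi divergence of order `α > 1`, for nonnegative weights. -/
theorem rpow_sum_le_renyi_mul_sum {ι : Type*} (s : Finset ι) (p q : ι → ℝ)
    (hp : ∀ i, 0 ≤ p i) (hq : ∀ i, 0 ≤ q i) (hpq : ∀ i, 0 < p i → 0 < q i)
    {α : ℝ} (hα : 1 < α) :
    (∑ i ∈ s, p i) ^ (α / (α - 1)) ≤
      (∑ i ∈ s, p i ^ α * q i ^ (1 - α)) ^ (1 / (α - 1)) * ∑ i ∈ s, q i := by
  have hα0 : 0 < α := by linarith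
  have hα1 : 0 < α - 1 := by linarith
  have holder := Real.inner_le_weight_mul_Lp_of_nonneg s hα.le q (fun i => p i / q i) hq
    fun i => div_nonneg (hp i) (hq i)
  have hlin : ∀ i, q i * (p i / q i) = p i := fun i => by
    rcases (hp i).eq_or_lt with h | h
    · simp [← h]
    · exact mul_div_cancel₀ _ (hpq i h).ne'
  have hpow : ∀ i, q i * (p i / q i) ^ α = p i ^ α * q i ^ (1 - α) := fun i => by
    rcases (hp i).eq_or_lt with h | h
    · simp [← h, Real.zero_rpow hα0.ne']
    · rw [Real.div_rpow (hp i) (hq i), Real.rpow_sub (hpq i h), Real.rpow_one]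
      ring
  simp only [hlin, hpow] at holder
  have hQ : 0 ≤ ∑ i ∈ s, q i := Finset.sum_nonneg fun i _ => hq i
  have hR : 0 ≤ ∑ i ∈ s, p i ^ α * q i ^ (1 - α) := Finset.sum_nonneg fun i _ =>
    mul_nonneg (Real.rpow_nonneg (hp i) _) (Real.rpow_nonneg (hq i) _)
  calc _ ≤ ((∑ i ∈ s, q i) ^ (1 - α⁻¹) *
        (∑ i ∈ s, p i ^ α * q i ^ (1 - α)) ^ α⁻¹) ^ (α / (α - 1)) :=
        Real.rpow_le_rpow (Finset.sum_nonneg fun i _ => hp i) holder (by positivity)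
    _ = _ := by
        rw [Real.mul_rpow (by positivity) (by positivity), ← Real.rpow_mul hQ,
          ← Real.rpow_mul hR, mul_comm,
          show (1 - α⁻¹) * (α / (α - 1)) = 1 by field_simp,
          show α⁻¹ * (α / (α - 1)) = 1 / (α - 1) by field_simp, Real.rpow_one]

/-- (Probability preservation + multiplicativity of the Rényi divergence
over products.) For probability mass functions `P, Q` on a finite nonempty type `Y` with
`supp P ⊆ supp Q`, `α > 1`, and any event `E` on `Fin r → Y`:
`(P^{⊗r}(E))^{α/(α−1)} ≤ R_α(P‖Q)^r · Q^{⊗r}(E)`, where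
`R_α(P‖Q) = (∑_{y ∈ supp P} P y ^ α · Q y ^ (1−α))^{1/(α−1)}`. -/
theorem stmt11 {Y : Type*} [Fintype Y] [Nonempty Y]
    (P Q : Y → ℝ) (hP0 : ∀ y, 0 ≤ P y) (hP1 : ∑ y, P y = 1)
    (hQ0 : ∀ y, 0 ≤ Q y) (hQ1 : ∑ y, Q y = 1)
    (hsupp : ∀ y, 0 < P y → 0 < Q y)
    (α : ℝ) (hα : 1 < α) (r : ℕ) (E : Finset (Fin r → Y)) :
    (∑ ω ∈ E, ∏ i, P (ω i)) ^ (α / (α - 1)) ≤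
      ((∑ y ∈ Finset.univ.filter (fun y => 0 < P y),
          P y ^ α * Q y ^ (1 - α)) ^ (1 / (α - 1))) ^ r *
        ∑ ω ∈ E, ∏ i, Q (ω i) := by
  have hterm : ∀ y, 0 ≤ P y ^ α * Q y ^ (1 - α) := fun y =>
    mul_nonneg (Real.rpow_nonneg (hP0 y) _) (Real.rpow_nonneg (hQ0 y) _)
  have hfilter : ∑ y ∈ Finset.univ.filter (fun y => 0 < P y), P y ^ α * Q y ^ (1 - α) =
      ∑ y, P y ^ α * Q y ^ (1 - α) := by
    refine Finset.sum_filter_of_ne fun y _ hy => (hP0 y).lt_of_ne fun h => hy ?_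
    simp [← h, Real.zero_rpow (by linarith : α ≠ 0)]
  have hprod : ∀ ω : Fin r → Y, (∏ i, P (ω i)) ^ α * (∏ i, Q (ω i)) ^ (1 - α) =
      ∏ i, (P (ω i) ^ α * Q (ω i) ^ (1 - α)) := fun ω => by
    rw [Finset.prod_mul_distrib, Real.finsetProd_rpow _ _ fun i _ => hP0 (ω i),
      Real.finsetProd_rpow _ _ fun i _ => hQ0 (ω i)]
  have hdom : ∀ ω : Fin r → Y, 0 < ∏ i, P (ω i) → 0 < ∏ i, Q (ω i) := fun ω h =>
    Finset.prod_pos fun i _ => hsupp _ <|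
      (hP0 (ω i)).lt_of_ne' (Finset.prod_ne_zero_iff.1 h.ne' i (Finset.mem_univ i))
  refine (rpow_sum_le_renyi_mul_sum E (fun ω => ∏ i, P (ω i)) (fun ω => ∏ i, Q (ω i))
    (fun ω => Finset.prod_nonneg fun i _ => hP0 _)
    (fun ω => Finset.prod_nonneg fun i _ => hQ0 _) hdom hα).trans ?_
  refine mul_le_mul_of_nonneg_right ?_
    (Finset.sum_nonneg fun ω _ => Finset.prod_nonneg fun i _ => hQ0 _)
  simp only [hprod]
  rw [hfilter, Real.rpow_pow_comm (Finset.sum_nonneg fun y _ => hterm y), Fintype.sum_pow]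
  refine Real.rpow_le_rpow
    (Finset.sum_nonneg fun ω _ => Finset.prod_nonneg fun i _ => hterm _) ?_
    (one_div_nonneg.2 (by linarith))
  exact Finset.sum_le_sum_of_subset_of_nonneg (Finset.subset_univ _)
    fun ω _ _ => Finset.prod_nonneg fun i _ => hterm _
end

section
/- For every real ε ∈ (0, 1] and every natural number q such that 2·q·arcsin(√ε) ≤ π/2, the following two-sided bound holds: (8/π)·q·√ε ≤ 2·sin(2·q·arcsin(√ε)) ≤ 2·π·q·√ε. -/
/-- (Tightness of the Grover trace-distance bound.) For `ε ∈ (0, 1]` and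
`q : ℕ` with `2·q·arcsin √ε ≤ π/2`, the trace distance `2·sin(2·q·arcsin √ε)` between the
Grover state after `q` iterations and the initial state satisfies
`(8/π)·q·√ε ≤ 2·sin(2·q·arcsin √ε) ≤ 2·π·q·√ε`. -/
theorem stmt16 (ε : ℝ) (hε0 : 0 < ε) (hε1 : ε ≤ 1) (q : ℕ)
    (hq : 2 * q * Real.arcsin (Real.sqrt ε) ≤ Real.pi / 2) :
    (8 / Real.pi) * q * Real.sqrt ε ≤
        2 * Real.sin (2 * q * Real.arcsin (Real.sqrt ε)) ∧
      2 * Real.sin (2 * q * Real.arcsin (Real.sqrt ε)) ≤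
        2 * Real.pi * q * Real.sqrt ε := by
  set s := Real.sqrt ε
  have hs0 : 0 ≤ s := Real.sqrt_nonneg ε
  have hs1 : s ≤ 1 := Real.sqrt_le_one.mpr hε1
  have ha0 : 0 ≤ Real.arcsin s := Real.arcsin_nonneg.mpr hs0
  have hsin : Real.sin (Real.arcsin s) = s := Real.sin_arcsin (by linarith) hs1
  have hs_le : s ≤ Real.arcsin s := hsin.symm.trans_le (Real.sin_le ha0)
  have hle_s : 2 / Real.pi * Real.arcsin s ≤ s :=
    (Real.mul_le_sin ha0 (Real.arcsin_le_pi_div_two s)).trans_eq hsin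
  have ha_le : Real.arcsin s ≤ Real.pi / 2 * s := by
    calc Real.arcsin s = Real.pi / 2 * (2 / Real.pi * Real.arcsin s) := by field_simp
      _ ≤ Real.pi / 2 * s := by gcongr
  have hx0 : 0 ≤ 2 * q * Real.arcsin s := by positivity
  constructor
  · calc (8 / Real.pi) * q * s ≤ (8 / Real.pi) * q * Real.arcsin s := by gcongr
      _ = 2 * (2 / Real.pi * (2 * q * Real.arcsin s)) := by ring
      _ ≤ 2 * Real.sin (2 * q * Real.arcsin s) := by
        gcongr
        exact Real.mul_le_sin hx0 hq
  · calc 2 * Real.sin (2 * q * Real.arcsin s) ≤ 2 * (2 * q * Real.arcsin s) := by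
          gcongr
          exact Real.sin_le hx0
      _ ≤ 2 * (2 * q * (Real.pi / 2 * s)) := by gcongr
      _ = 2 * Real.pi * q * s := by ring
end
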